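/- Let p ≥ 1 be an integer, L_p > 0, T ≥ 1 an integer, D > 0, and let f̄, X̄, Ȳ be the hard instance f̄(x,y) = (L_p/(2^{p+1} p!)) ( y_1 (1 − x_1)^p + Σ_{i=1}^{T} y_{i+1} (x_i − x_{i+1})^p ), X̄ = {x ∈ ℝ^{T+1} : 1 ≥ x_1 ≥ … ≥ x_{T+1} ≥ 0}, Ȳ = [0,1]^{T+1}. Set β = √(2(T+1))/D, f(x,y) = f̄(βx, βy)/β^{p+1}, 𝒳 = X̄/β, 𝒴 = Ȳ/β. Then for every (x,y) ∈ 𝒳 × 𝒴 with x_{T+1} = 0 and y_{T+1} = 0, the duality gap satisfies Gap_f(x,y) = max_{y'∈𝒴} f(x,y') − min_{x'∈𝒳} f(x',y) ≥ L_p D^{p+1} / (2^{(3p+3)/2} p! (T+1)^{(3p−1)/2}). -/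

import Mathlib

noncomputable section

/-- A chain of `n + 2` values descending from `1` through `u` to `u (Fin.last n)` telescopes. -/
theorem one_sub_add_sum_sub_succ (n : ℕ) (u : Fin (n + 1) → ℝ) :
    1 - u 0 + ∑ i : Fin n, (u i.castSucc - u i.succ) = 1 - u (Fin.last n) := by
  have h1 := Fin.sum_univ_succ u
  have h2 := Fin.sum_univ_castSucc u
  rw [Finset.sum_sub_distrib]
  linarith

/-- By the power mean inequality, the `p`-th powers of the `n + 1` steps of a chain descending
from `1` to `0` sum to at least `1 / (n + 1) ^ (p - 1)`. -/
theorem inv_pow_le_sum_step_pow (p n : ℕ) (hp : 1 ≤ p) (u : Fin (n + 1) → ℝ)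
    (h_first : u 0 ≤ 1) (h_anti : ∀ i : Fin n, u i.succ ≤ u i.castSucc)
    (h_last : u (Fin.last n) = 0) :
    (((n : ℝ) + 1) ^ (p - 1))⁻¹ ≤
      (1 - u 0) ^ p + ∑ i : Fin n, (u i.castSucc - u i.succ) ^ p := by
  obtain ⟨q, rfl⟩ := Nat.exists_eq_add_of_le' hp
  let d : Fin (n + 1) → ℝ := Fin.cons (1 - u 0) fun i => u i.castSucc - u i.succ
  have hd : ∀ i, 0 ≤ d i := Fin.cases (by simpa [d] using h_first) (by simpa [d] using h_anti)
  have h_sum : ∑ i, d i = 1 := by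
    rw [Fin.sum_univ_succ]
    simpa [d, h_last] using one_sub_add_sum_sub_succ n u
  have h_mean := pow_sum_div_card_le_sum_pow (s := Finset.univ) (fun i _ => hd i) q
  rw [h_sum, Fin.sum_univ_succ] at h_mean
  simpa [d] using h_mean

/-- The constant of the rescaled instance, with the scale `√(2 m) / D` expanded in powers
of `2` and `m`. -/
theorem rescaled_constant_eq (p : ℕ) (hp : 1 ≤ p) {L D m : ℝ} (hD : 0 < D) (hm : 0 < m) :
    L / (2 ^ (p + 1) * (p.factorial : ℝ)) * (m ^ (p - 1))⁻¹ / (√(2 * m) / D) ^ (p + 1) =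
      L * D ^ (p + 1) / ((2 : ℝ) ^ ((3 * (p : ℝ) + 3) / 2) * (p.factorial : ℝ) *
        m ^ ((3 * (p : ℝ) - 1) / 2)) := by
  have h_two : (2 : ℝ) ^ ((3 * (p : ℝ) + 3) / 2) = 2 ^ (p + 1) * √2 ^ (p + 1) := by
    rw [Real.sqrt_eq_rpow, ← Real.rpow_mul_natCast zero_le_two, ← Real.rpow_natCast,
      ← Real.rpow_add zero_lt_two]
    congr 1
    push_cast
    ring
  have h_m : m ^ ((3 * (p : ℝ) - 1) / 2) = m ^ (p - 1) * √m ^ (p + 1) := by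
    rw [Real.sqrt_eq_rpow, ← Real.rpow_mul_natCast hm.le, ← Real.rpow_natCast,
      ← Real.rpow_add hm]
    congr 1
    push_cast [Nat.cast_sub hp]
    ring
  rw [h_two, h_m, Real.sqrt_mul zero_le_two, div_pow, mul_pow]
  field_simp

/-- duality-gap lower bound for the rescaled hard instance
`f(x,y) = f̄(βx, βy)/β^(p+1)` on the rescaled domain `𝒳 × 𝒴 = (X̄/β) × (Ȳ/β)`
of diameter `D`, where `β = √(2(T+1))/D`.  For every `(x,y) ∈ 𝒳 × 𝒴` with
vanishing last coordinates, the duality gap of `f` is at least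
`L_p D^(p+1) / (2^((3p+3)/2) p! (T+1)^((3p−1)/2))`. -/
theorem stmt17 (p T : ℕ) (hp : 1 ≤ p) (hT : 1 ≤ T) (Lp D : ℝ) (hLp : 0 < Lp) (hD : 0 < D)
    (fbar : EuclideanSpace ℝ (Fin (T + 1)) → EuclideanSpace ℝ (Fin (T + 1)) → ℝ)
    (hfbar : fbar = fun x y => Lp / (2 ^ (p + 1) * (p.factorial : ℝ)) *
      (y 0 * (1 - x 0) ^ p + ∑ i : Fin T, y i.succ * (x i.castSucc - x i.succ) ^ p))
    (Xbar : Set (EuclideanSpace ℝ (Fin (T + 1))))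
    (hXbar : Xbar = {x | x 0 ≤ 1 ∧ (∀ i : Fin T, x i.succ ≤ x i.castSucc) ∧ 0 ≤ x (Fin.last T)})
    (Ybar : Set (EuclideanSpace ℝ (Fin (T + 1))))
    (hYbar : Ybar = {y | ∀ i, 0 ≤ y i ∧ y i ≤ 1})
    (β : ℝ) (hβ : β = Real.sqrt (2 * ((T : ℝ) + 1)) / D)
    (f : EuclideanSpace ℝ (Fin (T + 1)) → EuclideanSpace ℝ (Fin (T + 1)) → ℝ)
    (hf : f = fun x y => fbar (β • x) (β • y) / β ^ (p + 1))
    (X Y : Set (EuclideanSpace ℝ (Fin (T + 1))))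
    (hX : X = {x | β • x ∈ Xbar}) (hY : Y = {y | β • y ∈ Ybar})
    (x y : EuclideanSpace ℝ (Fin (T + 1))) (hx : x ∈ X) (hy : y ∈ Y)
    (hxlast : x (Fin.last T) = 0) (hylast : y (Fin.last T) = 0) :
    sSup ((fun y' => f x y') '' Y) - sInf ((fun x' => f x' y) '' X)
      ≥ Lp * D ^ (p + 1) /
        ((2 : ℝ) ^ ((3 * (p : ℝ) + 3) / 2) * (p.factorial : ℝ) *
          ((T : ℝ) + 1) ^ ((3 * (p : ℝ) - 1) / 2)) := by
  have hm : (0 : ℝ) < (T : ℝ) + 1 := by positivity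
  have hβ_pos : 0 < β := by rw [hβ]; positivity
  subst hfbar hXbar hYbar hf hX hY
  simp only [Set.mem_ofPred_eq, PiLp.smul_apply, smul_eq_mul] at hx hy ⊢
  obtain ⟨hx_first, hx_anti, -⟩ := hx
  set c : ℝ := Lp / (2 ^ (p + 1) * (p.factorial : ℝ)) with hc
  have hc_pos : 0 < c := by positivity
  let e : EuclideanSpace ℝ (Fin (T + 1)) := WithLp.toLp 2 fun _ => β⁻¹
  have he : ∀ i, β * e i = 1 := fun i => mul_inv_cancel₀ hβ_pos.ne'
  have h_inf : sInf ((fun x' : EuclideanSpace ℝ (Fin (T + 1)) =>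
      c * (β * y 0 * (1 - β * x' 0) ^ p + ∑ i : Fin T, β * y i.succ *
        (β * x' i.castSucc - β * x' i.succ) ^ p) / β ^ (p + 1)) ''
      {x | β * x 0 ≤ 1 ∧ (∀ i : Fin T, β * x i.succ ≤ β * x i.castSucc) ∧
        0 ≤ β * x (Fin.last T)}) ≤ 0 := by
    refine csInf_le ⟨0, ?_⟩ ⟨e, ?_, ?_⟩
    · rintro _ ⟨x', ⟨h_first, h_anti, -⟩, rfl⟩
      have h_head : 0 ≤ β * y 0 * (1 - β * x' 0) ^ p :=
        mul_nonneg (hy 0).1 (pow_nonneg (sub_nonneg.2 h_first) p)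
      have h_tail : 0 ≤ ∑ i : Fin T, β * y i.succ * (β * x' i.castSucc - β * x' i.succ) ^ p :=
        Finset.sum_nonneg fun i _ =>
          mul_nonneg (hy i.succ).1 (pow_nonneg (sub_nonneg.2 (h_anti i)) p)
      positivity
    · simp [he]
    · simp [he, Nat.one_le_iff_ne_zero.1 hp]
  have h_sup : c * ((1 - β * x 0) ^ p + ∑ i : Fin T, (β * x i.castSucc - β * x i.succ) ^ p) /
      β ^ (p + 1) ≤ sSup ((fun y' : EuclideanSpace ℝ (Fin (T + 1)) =>
      c * (β * y' 0 * (1 - β * x 0) ^ p + ∑ i : Fin T, β * y' i.succ *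
        (β * x i.castSucc - β * x i.succ) ^ p) / β ^ (p + 1)) ''
      {y | ∀ i, 0 ≤ β * y i ∧ β * y i ≤ 1}) := by
    refine le_csSup ⟨c * ((1 - β * x 0) ^ p +
      ∑ i : Fin T, (β * x i.castSucc - β * x i.succ) ^ p) / β ^ (p + 1), ?_⟩ ⟨e, ?_, ?_⟩
    · rintro _ ⟨y', hy', rfl⟩
      dsimp only
      gcongr with i
      · exact mul_le_of_le_one_left (pow_nonneg (sub_nonneg.2 hx_first) p) (hy' 0).2
      · exact mul_le_of_le_one_left (pow_nonneg (sub_nonneg.2 (hx_anti i)) p) (hy' i.succ).2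
    · simp [he]
    · simp [he]
  have h_steps := inv_pow_le_sum_step_pow p T hp (fun i => β * x i) hx_first hx_anti
    (by simp [hxlast])
  rw [ge_iff_le, ← rescaled_constant_eq p hp hD hm, ← hc, ← hβ]
  refine le_trans ?_ (h_sup.trans (le_sub_self_iff _ |>.2 h_inf))
  gcongr
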